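/- Let B be an annihilator hypercentral skew brace. Then the following statements are equivalent: (1) B is finitely generated as a skew brace; (2) B is finitely presented as a skew brace; (3) the group (B,+) is finitely generated; (4) the group (B,∘) is finitely generated. -/

import Mathlib

universe u v

/-- A skew (left) brace: two group structures `(B,+)` and `(B,∘)` on the same set,
sharing the same identity element `zero` (recall that in any skew brace `0 = 1`),
satisfying the skew left distributive law `a ∘ (b + c) = a ∘ b - a + a ∘ c`. -/
structure SkewBrace (B : Type u) where
  add : B → B → B
  zero : B
  neg : B → B
  mul : B → B → B
  inv : B → B
  add_assoc : ∀ a b c, add (add a b) c = add a (add b c)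
  zero_add : ∀ a, add zero a = a
  add_zero : ∀ a, add a zero = a
  neg_add : ∀ a, add (neg a) a = zero
  add_neg : ∀ a, add a (neg a) = zero
  mul_assoc : ∀ a b c, mul (mul a b) c = mul a (mul b c)
  zero_mul : ∀ a, mul zero a = a
  mul_zero : ∀ a, mul a zero = a
  inv_mul : ∀ a, mul (inv a) a = zero
  mul_inv : ∀ a, mul a (inv a) = zero
  compat : ∀ a b c, mul a (add b c) = add (add (mul a b) (neg a)) (mul a c)

namespace SkewBrace

variable {B C Q : Type u}

/-- `λ_a (b) = -a + a ∘ b`. -/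
def lam (S : SkewBrace B) (a b : B) : B := S.add (S.neg a) (S.mul a b)

/-- `a ∗ b = λ_a(b) - b = -a + a ∘ b - b`. -/
def star (S : SkewBrace B) (a b : B) : B := S.add (S.lam a b) (S.neg b)

/-- A sub-skew brace: a subset containing the identity and closed under both group
operations and both inverses. -/
def IsSub (S : SkewBrace B) (T : Set B) : Prop :=
  S.zero ∈ T ∧ (∀ a ∈ T, ∀ b ∈ T, S.add a b ∈ T) ∧ (∀ a ∈ T, S.neg a ∈ T) ∧
    (∀ a ∈ T, ∀ b ∈ T, S.mul a b ∈ T) ∧ (∀ a ∈ T, S.inv a ∈ T)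

/-- The sub-skew brace generated by a subset. -/
def subGen (S : SkewBrace B) (X : Set B) : Set B := ⋂₀ {T | S.IsSub T ∧ X ⊆ T}

/-- A skew brace is finitely generated if a finite subset generates it. -/
def FinitelyGenerated (S : SkewBrace B) : Prop := ∃ T : Finset B, S.subGen ↑T = Set.univ

/-- A subgroup of the additive group `(B,+)`. -/
def IsAddSubgroup (S : SkewBrace B) (T : Set B) : Prop :=
  S.zero ∈ T ∧ (∀ a ∈ T, ∀ b ∈ T, S.add a b ∈ T) ∧ ∀ a ∈ T, S.neg a ∈ T

/-- A subgroup of the multiplicative group `(B,∘)`. -/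
def IsMulSubgroup (S : SkewBrace B) (T : Set B) : Prop :=
  S.zero ∈ T ∧ (∀ a ∈ T, ∀ b ∈ T, S.mul a b ∈ T) ∧ ∀ a ∈ T, S.inv a ∈ T

/-- The additive subgroup generated by a subset. -/
def addClosure (S : SkewBrace B) (X : Set B) : Set B := ⋂₀ {T | S.IsAddSubgroup T ∧ X ⊆ T}

/-- The multiplicative subgroup generated by a subset. -/
def mulClosure (S : SkewBrace B) (X : Set B) : Set B := ⋂₀ {T | S.IsMulSubgroup T ∧ X ⊆ T}

/-- The group `(B,+)` is finitely generated. -/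
def AddFG (S : SkewBrace B) : Prop := ∃ T : Finset B, S.addClosure ↑T = Set.univ

/-- The group `(B,∘)` is finitely generated. -/
def MulFG (S : SkewBrace B) : Prop := ∃ T : Finset B, S.mulClosure ↑T = Set.univ

/-- An ideal of a skew brace: a subgroup of `(B,+)`, normal in `(B,+)` and in `(B,∘)`,
invariant under all the maps `λ_b`. -/
def IsIdeal (S : SkewBrace B) (I : Set B) : Prop :=
  S.IsAddSubgroup I ∧ (∀ b : B, ∀ a ∈ I, S.add (S.add b a) (S.neg b) ∈ I) ∧
    (∀ b : B, ∀ a ∈ I, S.mul (S.mul b a) (S.inv b) ∈ I) ∧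
    ∀ b : B, ∀ a ∈ I, S.lam b a ∈ I

/-- The ideal generated by a subset (the smallest ideal containing it). -/
def idealGen (S : SkewBrace B) (X : Set B) : Set B := ⋂₀ {I | S.IsIdeal I ∧ X ⊆ I}

/-- A homomorphism of skew braces. -/
def IsHom (S : SkewBrace B) (T : SkewBrace C) (f : B → C) : Prop :=
  (∀ a b, f (S.add a b) = T.add (f a) (f b)) ∧ ∀ a b, f (S.mul a b) = T.mul (f a) (f b)

/-- `SF` together with `ι : X → F` is the free skew brace on `X`: every map from `X`
to a skew brace extends uniquely to a homomorphism. -/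
def IsFreeOn {F : Type u} {X : Type v} (SF : SkewBrace F) (ι : X → F) : Prop :=
  ∀ (C : Type u) (SC : SkewBrace C) (f : X → C),
    ∃! g : F → C, IsHom SF SC g ∧ ∀ x, g (ι x) = f x

/-- A skew brace is finitely presented if it is the image of a free skew brace on a
finite set under a homomorphism whose kernel is generated, as an ideal, by finitely
many elements. -/
def FinitelyPresented (S : SkewBrace B) : Prop :=
  ∃ (F : Type u) (SF : SkewBrace F) (m : ℕ) (ι : Fin m → F) (θ : F → B),
    IsFreeOn SF ι ∧ IsHom SF S θ ∧ Function.Surjective θ ∧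
      ∃ R : Finset F, {x | θ x = S.zero} = SF.idealGen ↑R

/-- `π : B → Q` realizes `Q` as the quotient skew brace `B/I`. -/
def IsQuotientBy (S : SkewBrace B) (I : Set B) (SQ : SkewBrace Q) (π : B → Q) : Prop :=
  IsHom S SQ π ∧ Function.Surjective π ∧ {x | π x = SQ.zero} = I

/-- The group `(B,+)` is finitely presented (as an abstract group). -/
def AddFP (S : SkewBrace B) : Prop :=
  ∃ (m : ℕ) (f : FreeGroup (Fin m) → B),
    (∀ x y, f (x * y) = S.add (f x) (f y)) ∧ Function.Surjective f ∧
      ∃ R : Finset (FreeGroup (Fin m)),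
        {x | f x = S.zero} = ↑(Subgroup.normalClosure (R : Set (FreeGroup (Fin m))))

/-- The group `(B,∘)` is finitely presented (as an abstract group). -/
def MulFP (S : SkewBrace B) : Prop :=
  ∃ (m : ℕ) (f : FreeGroup (Fin m) → B),
    (∀ x y, f (x * y) = S.mul (f x) (f y)) ∧ Function.Surjective f ∧
      ∃ R : Finset (FreeGroup (Fin m)),
        {x | f x = S.zero} = ↑(Subgroup.normalClosure (R : Set (FreeGroup (Fin m))))

/-- The ascending chain condition on sub-skew braces. -/
def SubACC (S : SkewBrace B) : Prop :=
  ∀ f : ℕ → Set B, Monotone f → (∀ n, S.IsSub (f n)) → ∃ n, ∀ m, n ≤ m → f m = f n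

/-- The ascending chain condition on subgroups of `(B,+)`. -/
def AddACC (S : SkewBrace B) : Prop :=
  ∀ f : ℕ → Set B, Monotone f → (∀ n, S.IsAddSubgroup (f n)) → ∃ n, ∀ m, n ≤ m → f m = f n

/-- The socle `Soc(B) = Ker(λ) ∩ Z(B,+)`. -/
def soc (S : SkewBrace B) : Set B :=
  {x | (∀ b, S.lam x b = b) ∧ ∀ b, S.add x b = S.add b x}

/-- The centre of the additive group `(B,+)`. -/
def addCenter (S : SkewBrace B) : Set B := {x | ∀ b, S.add x b = S.add b x}

/-- The preimage in `B` of `Ann(B/I)` (for `I` an ideal): the set of `x` such that,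
modulo `I`, `λ_x = id`, `x` is central in `(B,+)` and `x` is central in `(B,∘)`. -/
def annStep (S : SkewBrace B) (I : Set B) : Set B :=
  {x | (∀ b, S.add (S.lam x b) (S.neg b) ∈ I) ∧
       (∀ b, S.add (S.add x b) (S.neg (S.add b x)) ∈ I) ∧
       ∀ b, S.mul (S.mul x b) (S.inv (S.mul b x)) ∈ I}

/-- The preimage in `B` of `Soc(B/I)` (for `I` an ideal). -/
def socStep (S : SkewBrace B) (I : Set B) : Set B :=
  {x | (∀ b, S.add (S.lam x b) (S.neg b) ∈ I) ∧
       ∀ b, S.add (S.add x b) (S.neg (S.add b x)) ∈ I}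

/-- The upper annihilator series `Ann_α(B)`, defined by transfinite recursion. -/
noncomputable def annSeries (S : SkewBrace B) (o : Ordinal.{v}) : Set B :=
  Ordinal.limitRecOn o {S.zero} (fun _ ih => S.annStep ih)
    fun _o _ ih => ⋃ β, ⋃ h : β < _o, ih β h

/-- The upper socle series `Soc_α(B)`, defined by transfinite recursion. -/
noncomputable def socSeries (S : SkewBrace B) (o : Ordinal.{v}) : Set B :=
  Ordinal.limitRecOn o {S.zero} (fun _ ih => S.socStep ih)
    fun _o _ ih => ⋃ β, ⋃ h : β < _o, ih β h

/-- The solution of the YBE associated with a skew brace: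
`r_B(a,b) = (λ_a(b), λ_a(b)⁻¹ ∘ a ∘ b)`. -/
def braceR (S : SkewBrace B) : B × B → B × B :=
  fun p => (S.lam p.1 p.2, S.mul (S.inv (S.lam p.1 p.2)) (S.mul p.1 p.2))

end SkewBrace

/-- The set-theoretic Yang–Baxter (braid) equation
`(r × id)(id × r)(r × id) = (id × r)(r × id)(id × r)`. -/
def ybe {X : Type u} (r : X × X → X × X) : Prop :=
  let r₁ : X × X × X → X × X × X := fun p =>
    ((r (p.1, p.2.1)).1, (r (p.1, p.2.1)).2, p.2.2)
  let r₂ : X × X × X → X × X × X := fun p => (p.1, r p.2)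
  r₁ ∘ r₂ ∘ r₁ = r₂ ∘ r₁ ∘ r₂

/-- A non-degenerate set-theoretic solution: `r` is bijective, satisfies the YBE, and
writing `r (x,y) = (σ_x y, τ_y x)`, all maps `σ_x` and `τ_y` are bijective. -/
def IsNonDegenerateSolution {X : Type u} (r : X × X → X × X) : Prop :=
  Function.Bijective r ∧ ybe r ∧
    (∀ x, Function.Bijective fun y => (r (x, y)).1) ∧
    ∀ y, Function.Bijective fun x => (r (x, y)).2

/-- `S` (with the distinguished map `ι : X → B`) is the structure skew brace of the
solution `(X,r)`: the multiplicative group of `S` is the structure group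
`G(X,r) = ⟨X | x y = σ_x(y) τ_y(x)⟩` (expressed by the relations holding together
with the universal property of the presentation) and `r_S ∘ (ι × ι) = (ι × ι) ∘ r`. -/
def IsStructureSkewBrace {X B : Type u} (r : X × X → X × X)
    (S : SkewBrace B) (ι : X → B) : Prop :=
  (∀ x y, S.mul (ι x) (ι y) = S.mul (ι (r (x, y)).1) (ι (r (x, y)).2)) ∧
  (∀ (H : Type u) [Group H] (f : X → H),
      (∀ x y, f x * f y = f (r (x, y)).1 * f (r (x, y)).2) →
      ∃! φ : B → H, (∀ a b, φ (S.mul a b) = φ a * φ b) ∧ ∀ x, φ (ι x) = f x) ∧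
  ∀ x y, S.braceR (ι x, ι y) = (ι (r (x, y)).1, ι (r (x, y)).2)

theorem Set.Finite.exists_subset_image_eq {α β : Type*} {f : α → β} {s : Set α} {t : Set β}
    (ht : t.Finite) (h : t ⊆ f '' s) : ∃ s' ⊆ s, s'.Finite ∧ f '' s' = t := by
  classical
  lift t to Finset β using ht
  obtain ⟨s', hs', rfl⟩ := Finset.subset_set_image_iff.1 h
  exact ⟨s', hs', s'.finite_toSet, by simp⟩

namespace AddSubgroup

variable {G : Type*} [AddGroup G]

/-- Subgroups of a finitely generated central subgroup are finitely generated. -/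
theorem exists_finite_closure_eq_of_le_center {R : Set G} (hR : R.Finite)
    (hc : closure R ≤ center G) {D : AddSubgroup G} (hD : D ≤ closure R) :
    ∃ E : Set G, E.Finite ∧ closure E = D := by
  let _ : AddCommGroup (closure R) :=
    { (inferInstance : AddGroup (closure R)) with
      add_comm := fun a b => Subtype.ext ((mem_center_iff.1 (hc b.2)) a) }
  have : AddGroup.FG (closure R) :=
    (AddGroup.fg_iff_addSubgroup_fg _).2 ((fg_iff _).2 ⟨R, rfl, hR⟩)
  have : Module.Finite ℤ (closure R) := Module.Finite.iff_addGroup_fg.2 inferInstance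
  have h : (D.addSubgroupOf (closure R)).FG := by
    have h := IsNoetherian.noetherian
      (AddSubgroup.toIntSubmodule (D.addSubgroupOf (closure R)))
    rwa [Submodule.fg_iff_addSubgroup_fg, AddSubgroup.toIntSubmodule_toAddSubgroup] at h
  obtain ⟨E, hE, hf⟩ := (fg_iff _).1 h
  refine ⟨(closure R).subtype '' E, hf.image _, ?_⟩
  rw [← AddMonoidHom.map_closure, hE]
  ext x
  simp only [mem_map, mem_addSubgroupOf, subtype_apply, Subtype.exists]
  constructor
  · rintro ⟨a, ha, h, rfl⟩
    exact h
  · intro hx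
    exact ⟨x, hD hx, hx, rfl⟩

theorem add_comm_of_mem_closure {Z R : Set G} (h : ∀ r ∈ R, ∀ z ∈ Z, r + z = z + r) {a u : G}
    (ha : a ∈ closure R) (hu : u ∈ closure Z) : a + u = u + a := by
  have h1 : ∀ r ∈ R, closure Z ≤ centralizer {r} := by
    intro r hr
    rw [closure_le]
    intro z hz
    exact mem_centralizer_iff.2 (by rintro _ rfl; exact h _ hr z hz)
  have h2 : closure R ≤ centralizer {u} := by
    rw [closure_le]
    intro r hr
    exact mem_centralizer_iff.2
      (by rintro _ rfl; exact (mem_centralizer_iff.1 (h1 r hr hu) r rfl).symm)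
  exact (mem_centralizer_iff.1 (h2 ha) u rfl).symm

theorem closure_le_center_of_commute {Z R : Set G} (hZ : closure Z = ⊤)
    (h : ∀ r ∈ R, ∀ z ∈ Z, r + z = z + r) : closure R ≤ center G := fun _ ha =>
  mem_center_iff.2 fun g => (add_comm_of_mem_closure h ha (hZ ▸ mem_top g)).symm

/-- If `N` is normally finitely generated in the finitely generated group `G` and `N / N'` is
central in `G / N'`, then `N'` is normally finitely generated as well. -/
theorem exists_finite_normalClosure_eq_of_commutator {Z : Set G} (hZf : Z.Finite)
    (hZ : closure Z = ⊤) {N N' : AddSubgroup G} [N'.Normal] (hle : N' ≤ N)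
    (hcomm : ∀ n ∈ N, ∀ g, n + g - (g + n) ∈ N') {W : Set G} (hWf : W.Finite)
    (hW : normalClosure W = N) :
    ∃ W' : Set G, W'.Finite ∧ normalClosure W' = N' := by
  set D : Set G := Set.image2 (fun w z => w + z - (z + w)) W Z with hDdef
  have hWN : ∀ w ∈ W, w ∈ N := fun w hw => hW ▸ subset_normalClosure hw
  have hDN : D ⊆ N' := by
    rintro _ ⟨w, hw, z, -, rfl⟩
    exact hcomm w (hWN w hw) z
  set M := normalClosure D with hM
  let π := QuotientAddGroup.mk' M
  have hπ : Function.Surjective π := QuotientAddGroup.mk'_surjective M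
  have hcen : closure (π '' W) ≤ center (G ⧸ M) := by
    refine closure_le_center_of_commute (Z := π '' Z) ?_ ?_
    · rw [← AddMonoidHom.map_closure, hZ, ← AddMonoidHom.range_eq_map,
        AddMonoidHom.range_eq_top.2 hπ]
    · rintro _ ⟨w, hw, rfl⟩ _ ⟨z, hz, rfl⟩
      rw [← sub_eq_zero, ← map_add, ← map_add, ← map_sub]
      exact (QuotientAddGroup.eq_zero_iff _).2 (subset_normalClosure ⟨w, hw, z, hz, rfl⟩)
  have hnormal : (closure (π '' W)).Normal :=
    ⟨fun n hn g => by
      have := mem_center_iff.1 (hcen hn) g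
      rw [this]; simpa using hn⟩
  have hNmap : N.map π = closure (π '' W) := by
    rw [← hW, map_normalClosure _ _ hπ]
    exact le_antisymm (normalClosure_le_normal subset_closure) closure_le_normalClosure
  obtain ⟨E, hEf, hE⟩ := exists_finite_closure_eq_of_le_center (hWf.image π) hcen
    (D := N'.map π) (hNmap ▸ map_mono hle)
  have hEN : E ⊆ π '' N' := by
    intro e he
    have : e ∈ N'.map π := hE ▸ subset_closure he
    exact this
  obtain ⟨E', hE'N, hE'f, rfl⟩ := hEf.exists_subset_image_eq hEN
  refine ⟨D ∪ E', (hWf.image2 _ hZf).union hE'f, le_antisymm ?_ ?_⟩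
  · exact normalClosure_le_normal (Set.union_subset hDN hE'N)
  · intro n hn
    have : π n ∈ (closure E').map π := by
      rw [AddMonoidHom.map_closure, hE]; exact mem_map_of_mem _ hn
    obtain ⟨s, hs, hsn⟩ := this
    have h1 : -s + n ∈ M := QuotientAddGroup.eq.1 hsn
    have h2 := add_mem
      (closure_le_normalClosure (closure_mono (Set.subset_union_right (s := D)) hs))
      (normalClosure_mono (Set.subset_union_left (t := E')) h1)
    simpa using h2

end AddSubgroup

namespace SkewBrace

/-- The underlying set of a skew brace, as a type carrying the two group structures. -/
def El {B : Type u} (_ : SkewBrace B) : Type u := B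

section Basic

variable {B : Type u} (S : SkewBrace B)

instance : AddGroup S.El where
  add := S.add
  zero := S.zero
  neg := S.neg
  add_assoc := S.add_assoc
  zero_add := S.zero_add
  add_zero := S.add_zero
  neg_add_cancel := S.neg_add
  nsmul := @nsmulRec B ⟨S.zero⟩ ⟨S.add⟩
  zsmul := @zsmulRec B ⟨S.zero⟩ ⟨S.add⟩ ⟨S.neg⟩ (@nsmulRec B ⟨S.zero⟩ ⟨S.add⟩)

instance : Group S.El where
  mul := S.mul
  one := S.zero
  inv := S.inv
  mul_assoc := S.mul_assoc
  one_mul := S.zero_mul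
  mul_one := S.mul_zero
  inv_mul_cancel := S.inv_mul

variable {S}

theorem one_eq_zero : (1 : S.El) = 0 := rfl

theorem mul_add_eq (a b c : S.El) : a * (b + c) = a * b + -a + a * c := S.compat a b c

@[simp] theorem mul_zero_eq (a : S.El) : a * 0 = a := mul_one a

@[simp] theorem zero_mul_eq (a : S.El) : 0 * a = a := one_mul a

variable (S) in
/-- The homomorphism `λ`, elementwise. -/
def lamHom (a : S.El) : S.El →+ S.El where
  toFun b := -a + a * b
  map_zero' := by simp
  map_add' b c := by rw [mul_add_eq]; simp only [_root_.add_assoc]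

theorem lamHom_apply (a b : S.El) : S.lamHom a b = -a + a * b := rfl

theorem add_lamHom (a b : S.El) : a + S.lamHom a b = a * b := by simp [lamHom_apply]

theorem lamHom_mul (a b c : S.El) : S.lamHom (a * b) c = S.lamHom a (S.lamHom b c) := by
  have h := map_add (S.lamHom a) b (S.lamHom b c)
  rw [add_lamHom, lamHom_apply, lamHom_apply a b, ← _root_.mul_assoc, neg_add_eq_iff_eq_add] at h
  rw [lamHom_apply, h]
  simp [_root_.add_assoc]

@[simp] theorem lamHom_zero (b : S.El) : S.lamHom 0 b = b := by simp [lamHom_apply]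

@[simp] theorem lamHom_one (b : S.El) : S.lamHom 1 b = b := lamHom_zero b

@[simp] theorem lamHom_inv_lamHom (a b : S.El) : S.lamHom a⁻¹ (S.lamHom a b) = b := by
  rw [← lamHom_mul]; simp

@[simp] theorem lamHom_lamHom_inv (a b : S.El) : S.lamHom a (S.lamHom a⁻¹ b) = b := by
  rw [← lamHom_mul]; simp

theorem inv_eq_neg_lamHom (a : S.El) : a⁻¹ = -S.lamHom a⁻¹ a := by
  simp [lamHom_apply, one_eq_zero]

variable (S) in
/-- Ideals, as additive subgroups. -/
structure Ideal extends AddSubgroup S.El where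
  isIdeal : S.IsIdeal carrier

/-- The bundled version of an ideal. -/
def IsIdeal.toIdeal {I : Set B} (h : S.IsIdeal I) : S.Ideal where
  carrier := I
  add_mem' ha hb := h.1.2.1 _ ha _ hb
  zero_mem' := h.1.1
  neg_mem' ha := h.1.2.2 _ ha
  isIdeal := h

instance : SetLike S.Ideal S.El where
  coe I := I.carrier
  coe_injective := by
    rintro ⟨I, _⟩ ⟨J, _⟩ h
    have : I = J := SetLike.coe_injective h
    subst this; rfl

instance : AddSubgroupClass S.Ideal S.El where
  add_mem {I} := I.add_mem'
  zero_mem I := I.zero_mem'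
  neg_mem {I} := I.neg_mem'

namespace Ideal

variable (I : S.Ideal)

theorem conj_mem (b : S.El) {a : S.El} (ha : a ∈ I) : b + a + -b ∈ I := I.isIdeal.2.1 b a ha

theorem mul_conj_mem (b : S.El) {a : S.El} (ha : a ∈ I) : b * a * b⁻¹ ∈ I :=
  I.isIdeal.2.2.1 b a ha

theorem lamHom_mem (b : S.El) {a : S.El} (ha : a ∈ I) : S.lamHom b a ∈ I :=
  I.isIdeal.2.2.2 b a ha

theorem neg_add_mem_iff {a b : S.El} : -a + b ∈ I ↔ a⁻¹ * b ∈ I := by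
  have h : -a + b = S.lamHom a (a⁻¹ * b) := by simp [lamHom_apply]
  rw [h]
  refine ⟨fun h => ?_, I.lamHom_mem a⟩
  simpa using I.lamHom_mem a⁻¹ h

instance : I.toAddSubgroup.Normal := ⟨fun _ hn g => I.conj_mem g hn⟩

/-- An ideal, as a multiplicative subgroup. -/
def toSubgroup : Subgroup S.El where
  carrier := I
  mul_mem' {a b} ha hb := by
    rw [← add_lamHom]
    exact add_mem (S := S.Ideal) ha (I.lamHom_mem a hb)
  one_mem' := zero_mem I
  inv_mem' {a} ha := by
    rw [inv_eq_neg_lamHom]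
    exact neg_mem (S := S.Ideal) (I.lamHom_mem _ ha)

instance : I.toSubgroup.Normal := ⟨fun _ hn g => I.mul_conj_mem g hn⟩

theorem rel_iff (a b : S.El) :
    QuotientAddGroup.con I.toAddSubgroup a b ↔ QuotientGroup.con I.toSubgroup a b := by
  change QuotientAddGroup.leftRel _ a b ↔ QuotientGroup.leftRel _ a b
  rw [QuotientAddGroup.leftRel_apply, QuotientGroup.leftRel_apply]
  exact I.neg_add_mem_iff

/-- The quotient of a skew brace by an ideal. -/
def quot : SkewBrace (QuotientAddGroup.con I.toAddSubgroup).Quotient where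
  add a b := a + b
  zero := 0
  neg a := -a
  mul := Quotient.map₂ (fun a b : S.El => a * b) fun a a' h b b' h' =>
    (I.rel_iff _ _).2 ((QuotientGroup.con I.toSubgroup).mul ((I.rel_iff _ _).1 h)
      ((I.rel_iff _ _).1 h'))
  inv := Quotient.map (fun a : S.El => a⁻¹) fun a a' h =>
    (I.rel_iff _ _).2 ((QuotientGroup.con I.toSubgroup).inv ((I.rel_iff _ _).1 h))
  add_assoc := _root_.add_assoc
  zero_add := _root_.zero_add
  add_zero := _root_.add_zero
  neg_add := neg_add_cancel
  add_neg := add_neg_cancel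
  mul_assoc := by
    rintro ⟨a⟩ ⟨b⟩ ⟨c⟩
    exact congrArg (Quotient.mk _) (_root_.mul_assoc a b c)
  zero_mul := by
    rintro ⟨a⟩
    exact congrArg (Quotient.mk _) (one_mul a)
  mul_zero := by
    rintro ⟨a⟩
    exact congrArg (Quotient.mk _) (mul_one a)
  inv_mul := by
    rintro ⟨a⟩
    exact congrArg (Quotient.mk _) (inv_mul_cancel a)
  mul_inv := by
    rintro ⟨a⟩
    exact congrArg (Quotient.mk _) (mul_inv_cancel a)
  compat := by
    rintro ⟨a⟩ ⟨b⟩ ⟨c⟩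
    exact congrArg (Quotient.mk _) (mul_add_eq a b c)

theorem exists_isQuotientBy :
    ∃ (Q : Type u) (T : SkewBrace Q) (π : B → Q), S.IsQuotientBy (I : Set S.El) T π := by
  refine ⟨_, I.quot, fun a => Quotient.mk _ a, ⟨fun _ _ => rfl, fun _ _ => rfl⟩,
    Quotient.mk_surjective, ?_⟩
  ext x
  exact QuotientAddGroup.eq_zero_iff (N := I.toAddSubgroup) (x : S.El)

end Ideal

end Basic

section Annihilator

variable {B : Type u} {S : SkewBrace B}

/-- Membership in the annihilator of a skew brace. -/
def IsAnn (x : S.El) : Prop :=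
  (∀ b : S.El, x + b = b + x) ∧ (∀ b : S.El, lamHom S x b = b) ∧ ∀ b : S.El, lamHom S b x = x

theorem IsAnn.mul_eq_add {x : S.El} (hx : IsAnn x) (b : S.El) : x * b = x + b := by
  rw [← add_lamHom, hx.2.1]

theorem IsAnn.mul_eq_add' {x : S.El} (hx : IsAnn x) (b : S.El) : b * x = b + x := by
  rw [← add_lamHom, hx.2.2]

theorem IsAnn.inv_eq_neg {x : S.El} (hx : IsAnn x) : x⁻¹ = -x := by
  rw [inv_eq_neg_lamHom, hx.2.2]

variable (S) in
/-- The annihilator of a skew brace. -/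
def annihilator : AddSubgroup S.El where
  carrier := {x | IsAnn x}
  zero_mem' := by simp [IsAnn]
  add_mem' {x y} hx hy := by
    refine ⟨fun b => ?_, fun b => ?_, fun b => ?_⟩
    · rw [_root_.add_assoc, hy.1, ← _root_.add_assoc, hx.1, _root_.add_assoc]
    · rw [← IsAnn.mul_eq_add hx, lamHom_mul, hy.2.1, hx.2.1]
    · rw [map_add, hx.2.2, hy.2.2]
  neg_mem' {x} hx := by
    refine ⟨fun b => ?_, fun b => ?_, fun b => ?_⟩
    · rw [neg_add_eq_iff_eq_add, ← _root_.add_assoc, hx.1, _root_.add_assoc,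
        add_neg_cancel, _root_.add_zero]
    · rw [← IsAnn.inv_eq_neg hx]
      conv_lhs => rw [← hx.2.1 b]
      exact lamHom_inv_lamHom x b
    · rw [map_neg, hx.2.2]

theorem isIdeal_of_le_annihilator {A : AddSubgroup S.El} (hA : A ≤ annihilator S) :
    S.IsIdeal (A : Set S.El) := by
  refine ⟨⟨A.zero_mem, fun _ ha _ hb => A.add_mem ha hb, fun _ ha => A.neg_mem ha⟩,
    fun (b a : S.El) ha => ?_, fun (b a : S.El) ha => ?_, fun (b a : S.El) ha => ?_⟩
  · change (b + a + -b : S.El) ∈ A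
    rwa [← (hA ha).1 b, add_neg_cancel_right]
  · change (b * a * b⁻¹ : S.El) ∈ A
    rwa [IsAnn.mul_eq_add' (hA ha), ← (hA ha).1 b, ← IsAnn.mul_eq_add (hA ha),
      mul_inv_cancel_right]
  · change lamHom S b a ∈ A
    rwa [(hA ha).2.2 b]

end Annihilator

section Generation

variable {B : Type u} {S : SkewBrace B}

theorem isIdeal_sInter {c : Set (Set B)} (hc : ∀ I ∈ c, S.IsIdeal I) : S.IsIdeal (⋂₀ c) :=
  ⟨⟨fun I hI => (hc I hI).1.1,
    fun a ha b hb I hI => (hc I hI).1.2.1 a (ha I hI) b (hb I hI),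
    fun a ha I hI => (hc I hI).1.2.2 a (ha I hI)⟩,
    fun b a ha I hI => (hc I hI).2.1 b a (ha I hI),
    fun b a ha I hI => (hc I hI).2.2.1 b a (ha I hI),
    fun b a ha I hI => (hc I hI).2.2.2 b a (ha I hI)⟩

theorem isSub_sInter {c : Set (Set B)} (hc : ∀ I ∈ c, S.IsSub I) : S.IsSub (⋂₀ c) :=
  ⟨fun I hI => (hc I hI).1,
    fun a ha b hb I hI => (hc I hI).2.1 a (ha I hI) b (hb I hI),
    fun a ha I hI => (hc I hI).2.2.1 a (ha I hI),
    fun a ha b hb I hI => (hc I hI).2.2.2.1 a (ha I hI) b (hb I hI),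
    fun a ha I hI => (hc I hI).2.2.2.2 a (ha I hI)⟩

theorem subset_subGen (X : Set B) : X ⊆ S.subGen X := fun _ hx _ hT => hT.2 hx

theorem isSub_subGen (X : Set B) : S.IsSub (S.subGen X) := isSub_sInter fun _ h => h.1

theorem subGen_subset {X T : Set B} (hT : S.IsSub T) (h : X ⊆ T) : S.subGen X ⊆ T :=
  fun _ hx => hx T ⟨hT, h⟩

theorem subset_idealGen (X : Set B) : X ⊆ S.idealGen X := fun _ hx _ hT => hT.2 hx

theorem isIdeal_idealGen (X : Set B) : S.IsIdeal (S.idealGen X) :=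
  isIdeal_sInter fun _ h => h.1

theorem idealGen_subset {X T : Set B} (hT : S.IsIdeal T) (h : X ⊆ T) : S.idealGen X ⊆ T :=
  fun _ hx => hx T ⟨hT, h⟩

theorem addClosure_eq (X : Set B) :
    S.addClosure X = (AddSubgroup.closure (G := S.El) X : Set S.El) := by
  apply Set.Subset.antisymm
  · exact fun _ hx => hx _ ⟨⟨zero_mem (M := S.El) _, fun _ ha _ hb => add_mem (M := S.El) ha hb,
      fun _ ha => neg_mem (G := S.El) ha⟩,
      AddSubgroup.subset_closure (G := S.El)⟩
  · intro x hx T hT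
    let T' : AddSubgroup S.El :=
      { carrier := T
        zero_mem' := hT.1.1
        add_mem' := fun ha hb => hT.1.2.1 _ ha _ hb
        neg_mem' := fun ha => hT.1.2.2 _ ha }
    exact (AddSubgroup.closure_le T').2 hT.2 hx

theorem mulClosure_eq (X : Set B) :
    S.mulClosure X = (Subgroup.closure (G := S.El) X : Set S.El) := by
  apply Set.Subset.antisymm
  · exact fun _ hx => hx _ ⟨⟨one_mem (M := S.El) _, fun _ ha _ hb => mul_mem (M := S.El) ha hb,
      fun _ ha => inv_mem (G := S.El) ha⟩,
      Subgroup.subset_closure (G := S.El)⟩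
  · intro x hx T hT
    let T' : Subgroup S.El :=
      { carrier := T
        one_mem' := hT.1.1
        mul_mem' := fun ha hb => hT.1.2.1 _ ha _ hb
        inv_mem' := fun ha => hT.1.2.2 _ ha }
    exact (Subgroup.closure_le T').2 hT.2 hx

/-- The stabiliser of an additive subgroup under `λ`. -/
def lamStabilizer (U : AddSubgroup S.El) : Subgroup S.El where
  carrier := {v | ∀ u ∈ U, lamHom S v u ∈ U ∧ lamHom S v⁻¹ u ∈ U}
  one_mem' := by simp
  mul_mem' {v w} hv hw u hu := by
    rw [mul_inv_rev, lamHom_mul, lamHom_mul]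
    exact ⟨(hv _ (hw u hu).1).1, (hw _ (hv u hu).2).2⟩
  inv_mem' {v} hv u hu := by
    rw [inv_inv]
    exact (hv u hu).symm

/-- The pointwise stabiliser of an additive subgroup under `λ`. -/
def lamFixing (A : AddSubgroup S.El) : Subgroup S.El where
  carrier := {v | ∀ a ∈ A, lamHom S v a = a}
  one_mem' := by simp
  mul_mem' {v w} hv hw a ha := by rw [lamHom_mul, hw a ha, hv a ha]
  inv_mem' {v} hv a ha := by
    conv_lhs => rw [← hv a ha]
    exact lamHom_inv_lamHom v a

/-- The additive subgroup of elements fixed by `λ_v`. -/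
def lamFixed (v : S.El) : AddSubgroup S.El := (lamHom S v).eqLocus (AddMonoidHom.id _)

/-- A finite criterion for the generators `R` of an ideal to lie in the annihilator: the defining
relations have to hold only on a set `Z` of generators, provided the additive subgroup
generated by `Z` is stable under the `λ_z`, meets the ideal in the additive subgroup
generated by `R`, and the multiplicative subgroup generated by `Z` supplements the ideal. -/
theorem isAnn_of_relations {Z R : Set S.El} (hRZ : R ⊆ Z) (hZ : S.subGen Z = Set.univ)
    (hcomm : ∀ r ∈ R, ∀ z ∈ Z, r + z = z + r)
    (hlam : ∀ r ∈ R, ∀ z ∈ Z, lamHom S r z = z)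
    (hlam' : ∀ r ∈ R, ∀ z ∈ Z, lamHom S z r = r)
    (hstab : ∀ z ∈ Z, ∀ z' ∈ Z, lamHom S z z' ∈ AddSubgroup.closure Z ∧
      lamHom S z⁻¹ z' ∈ AddSubgroup.closure Z)
    (hinter : ∀ u ∈ AddSubgroup.closure Z, u ∈ S.idealGen R → u ∈ AddSubgroup.closure R)
    (hsup : ∀ g : S.El, ∃ v ∈ Subgroup.closure Z, -v + g ∈ S.idealGen R) :
    Subgroup.closure Z = ⊤ ∧ ∀ r ∈ R, IsAnn r := by
  set U := AddSubgroup.closure Z with hU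
  set V := Subgroup.closure Z with hV
  set A := AddSubgroup.closure R with hA
  have hVU : V ≤ lamStabilizer U := by
    rw [hV, Subgroup.closure_le]
    intro z hz u hu
    have h1 : U ≤ U.comap (lamHom S z) := by
      rw [hU, AddSubgroup.closure_le]
      exact fun z' hz' => (hstab z hz z' hz').1
    have h2 : U ≤ U.comap (lamHom S z⁻¹) := by
      rw [hU, AddSubgroup.closure_le]
      exact fun z' hz' => (hstab z hz z' hz').2
    exact ⟨h1 hu, h2 hu⟩
  have hVsubU : ∀ v ∈ V, v ∈ U := by
    intro v hv
    rw [hV] at hv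
    induction hv using Subgroup.closure_induction with
    | mem z hz => exact AddSubgroup.subset_closure hz
    | one => exact zero_mem U
    | mul x y hx hy hxU hyU =>
      rw [← add_lamHom]
      exact add_mem hxU (hVU hx y hyU).1
    | inv x hx hxU =>
      rw [inv_eq_neg_lamHom]
      exact neg_mem (hVU hx x hxU).2
  have hfix : V ≤ lamFixing A := by
    rw [hV, Subgroup.closure_le]
    intro z hz
    have : A ≤ lamFixed z := by
      rw [hA, AddSubgroup.closure_le]
      exact fun r hr => hlam' r hr z hz
    exact fun a ha => this ha
  have hAV : ∀ a ∈ A, a ∈ V := by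
    intro a ha
    rw [hA] at ha
    induction ha using AddSubgroup.closure_induction with
    | mem r hr => exact Subgroup.subset_closure (hRZ hr)
    | zero => exact one_mem V
    | add x y hx hy hxV hyV =>
      have h := add_lamHom x y
      rw [hfix hxV y hy] at h
      rw [h]
      exact mul_mem hxV hyV
    | neg x hx hxV =>
      have h := inv_eq_neg_lamHom x
      rw [hfix (inv_mem hxV) x hx] at h
      rw [← h]
      exact inv_mem hxV
  have hUV : ∀ u ∈ U, u ∈ V := by
    intro u hu
    obtain ⟨v, hv, hvu⟩ := hsup u
    have ha : -v + u ∈ A := hinter _ (add_mem (neg_mem (hVsubU v hv)) hu) hvu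
    have h := add_lamHom v (-v + u)
    rw [hfix hv _ ha, add_neg_cancel_left] at h
    rw [h]
    exact mul_mem hv (hAV _ ha)
  have htop : ∀ x, x ∈ U := by
    intro x
    have hsub : S.IsSub (U : Set S.El) :=
      ⟨zero_mem U, fun _ ha _ hb => U.add_mem ha hb, fun _ ha => U.neg_mem ha,
        fun (a : S.El) ha (b : S.El) hb => hVsubU (a * b) (mul_mem (hUV a ha) (hUV b hb)),
        fun (a : S.El) ha => hVsubU a⁻¹ (inv_mem (hUV a ha))⟩
    exact subGen_subset hsub (AddSubgroup.subset_closure (G := S.El)) (hZ ▸ Set.mem_univ x)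
  refine ⟨(Subgroup.eq_top_iff' V).2 fun x => hUV x (htop x), fun r hr => ?_⟩
  refine ⟨fun b => ?_, fun b => ?_, fun b => ?_⟩
  · exact AddSubgroup.add_comm_of_mem_closure hcomm (AddSubgroup.subset_closure hr) (htop b)
  · have : U ≤ lamFixed r := by
      rw [hU, AddSubgroup.closure_le]
      exact fun z hz => hlam r hr z hz
    exact this (htop b)
  · exact hfix (hUV b (htop b)) r (AddSubgroup.subset_closure hr)

end Generation

section Hom

variable {B C : Type u} {S : SkewBrace B} {T : SkewBrace C}

/-- A skew brace homomorphism, as a homomorphism of additive groups. -/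
def IsHom.addHom {f : B → C} (hf : IsHom S T f) : S.El →+ T.El :=
  AddMonoidHom.mk' (G := T.El) (M := S.El) f hf.1

/-- A skew brace homomorphism, as a homomorphism of multiplicative groups. -/
def IsHom.mulHom {f : B → C} (hf : IsHom S T f) : S.El →* T.El :=
  MonoidHom.mk' (G := T.El) (M := S.El) f hf.2

theorem IsHom.addHom_mul {f : B → C} (hf : IsHom S T f) (x y : S.El) :
    hf.addHom (x * y) = hf.addHom x * hf.addHom y := hf.2 x y

theorem IsHom.addHom_inv {f : B → C} (hf : IsHom S T f) (x : S.El) :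
    hf.addHom x⁻¹ = (hf.addHom x)⁻¹ := map_inv hf.mulHom x

theorem IsHom.addHom_lamHom {f : B → C} (hf : IsHom S T f) (x y : S.El) :
    hf.addHom (lamHom S x y) = lamHom T (hf.addHom x) (hf.addHom y) := by
  rw [lamHom_apply, lamHom_apply, map_add, map_neg, hf.addHom_mul]

theorem IsHom.apply_zero {f : B → C} (hf : IsHom S T f) : f S.zero = T.zero :=
  hf.addHom.map_zero

theorem IsHom.apply_neg {f : B → C} (hf : IsHom S T f) (x : B) : f (S.neg x) = T.neg (f x) :=
  hf.addHom.map_neg x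

theorem IsHom.apply_inv {f : B → C} (hf : IsHom S T f) (x : B) : f (S.inv x) = T.inv (f x) :=
  hf.mulHom.map_inv x

theorem IsHom.isIdeal_preimage {f : B → C} (hf : IsHom S T f) {J : Set C} (hJ : T.IsIdeal J) :
    S.IsIdeal (f ⁻¹' J) := by
  have key : ∀ x : B, x ∈ f ⁻¹' J ↔ hf.addHom x ∈ hJ.toIdeal := fun _ => Iff.rfl
  refine ⟨⟨(key _).2 ?_, fun (a : S.El) ha (b : S.El) hb => (key _).2 ?_,
    fun (a : S.El) ha => (key _).2 ?_⟩, fun (b a : S.El) ha => (key _).2 ?_,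
    fun (b a : S.El) ha => (key _).2 ?_, fun (b a : S.El) ha => (key _).2 ?_⟩
  · change hf.addHom (0 : S.El) ∈ _
    rw [map_zero]
    exact zero_mem _
  · change hf.addHom (a + b : S.El) ∈ _
    rw [map_add]
    exact add_mem (S := T.Ideal) ha hb
  · change hf.addHom (-a : S.El) ∈ _
    rw [map_neg]
    exact neg_mem (S := T.Ideal) ha
  · change hf.addHom (b + a + -b : S.El) ∈ _
    rw [map_add, map_add, map_neg]
    exact Ideal.conj_mem _ _ ha
  · change hf.addHom (b * a * b⁻¹ : S.El) ∈ _
    rw [hf.addHom_mul, hf.addHom_mul, hf.addHom_inv]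
    exact Ideal.mul_conj_mem _ _ ha
  · change hf.addHom (lamHom S b a : S.El) ∈ _
    rw [hf.addHom_lamHom]
    exact Ideal.lamHom_mem _ _ ha

theorem IsHom.isIdeal_image {f : B → C} (hf : IsHom S T f) (hs : Function.Surjective f)
    {I : Set B} (hI : S.IsIdeal I) : T.IsIdeal (f '' I) := by
  refine ⟨⟨⟨_, hI.1.1, hf.apply_zero⟩, ?_, ?_⟩, ?_, ?_, ?_⟩
  · rintro _ ⟨a, ha, rfl⟩ _ ⟨b, hb, rfl⟩
    exact ⟨_, hI.1.2.1 a ha b hb, hf.1 a b⟩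
  · rintro _ ⟨a, ha, rfl⟩
    exact ⟨_, hI.1.2.2 a ha, hf.apply_neg a⟩
  all_goals
    intro b
    rintro _ ⟨a, ha, rfl⟩
    obtain ⟨b, rfl⟩ := hs b
  · exact ⟨_, hI.2.1 b a ha, by rw [hf.1, hf.1, hf.apply_neg]⟩
  · exact ⟨_, hI.2.2.1 b a ha, by rw [hf.2, hf.2, hf.apply_inv]⟩
  · exact ⟨_, hI.2.2.2 b a ha, hf.addHom_lamHom b a⟩

theorem IsHom.isSub_preimage {f : B → C} (hf : IsHom S T f) {J : Set C} (hJ : T.IsSub J) :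
    S.IsSub (f ⁻¹' J) := by
  refine ⟨?_, fun a ha b hb => ?_, fun a ha => ?_, fun a ha b hb => ?_, fun a ha => ?_⟩
  · rw [Set.mem_preimage, hf.apply_zero]
    exact hJ.1
  · rw [Set.mem_preimage, hf.1]
    exact hJ.2.1 _ ha _ hb
  · rw [Set.mem_preimage, hf.apply_neg]
    exact hJ.2.2.1 _ ha
  · rw [Set.mem_preimage, hf.2]
    exact hJ.2.2.2.1 _ ha _ hb
  · rw [Set.mem_preimage, hf.apply_inv]
    exact hJ.2.2.2.2 _ ha

theorem IsHom.isSub_range {f : B → C} (hf : IsHom S T f) : T.IsSub (Set.range f) := by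
  refine ⟨⟨S.zero, hf.apply_zero⟩, ?_, ?_, ?_, ?_⟩
  · rintro _ ⟨a, rfl⟩ _ ⟨b, rfl⟩
    exact ⟨_, hf.1 a b⟩
  · rintro _ ⟨a, rfl⟩
    exact ⟨_, hf.apply_neg a⟩
  · rintro _ ⟨a, rfl⟩ _ ⟨b, rfl⟩
    exact ⟨_, hf.2 a b⟩
  · rintro _ ⟨a, rfl⟩
    exact ⟨_, hf.apply_inv a⟩

theorem IsHom.subGen_image_eq_univ {f : B → C} (hf : IsHom S T f) (hs : Function.Surjective f)
    {X : Set B} (hX : S.subGen X = Set.univ) : T.subGen (f '' X) = Set.univ := by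
  refine Set.eq_univ_of_forall fun c => ?_
  obtain ⟨b, rfl⟩ := hs c
  have : S.subGen X ⊆ f ⁻¹' T.subGen (f '' X) :=
    subGen_subset (hf.isSub_preimage (isSub_subGen _)) fun x hx =>
      subset_subGen _ (Set.mem_image_of_mem f hx)
  exact this (hX ▸ Set.mem_univ b)

theorem IsHom.image_idealGen_subset {f : B → C} (hf : IsHom S T f) (X : Set B) :
    S.idealGen X ⊆ f ⁻¹' T.idealGen (f '' X) :=
  idealGen_subset (hf.isIdeal_preimage (isIdeal_idealGen _)) fun _ hx =>
    subset_idealGen _ (Set.mem_image_of_mem f hx)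

theorem IsQuotientBy.isHom {I : Set B} {f : B → C} (h : S.IsQuotientBy I T f) :
    IsHom S T f := h.1

theorem IsQuotientBy.mem_iff {I : Set B} {f : B → C} (h : S.IsQuotientBy I T f) (x : S.El) :
    x ∈ I ↔ h.isHom.addHom x = 0 := by
  obtain ⟨-, -, rfl⟩ := h
  rfl

theorem IsQuotientBy.surjective {I : Set B} {f : B → C} (h : S.IsQuotientBy I T f) :
    Function.Surjective h.isHom.addHom := h.2.1

theorem IsQuotientBy.neg_add_mem_iff {I : Set B} {f : B → C} (h : S.IsQuotientBy I T f)
    (x y : S.El) : (-x + y : S.El) ∈ I ↔ h.isHom.addHom x = h.isHom.addHom y := by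
  rw [h.mem_iff, map_add, map_neg, neg_add_eq_zero]

theorem exists_isQuotientBy {I : Set B} (hI : S.IsIdeal I) :
    ∃ (Q : Type u) (T : SkewBrace Q) (π : B → Q), S.IsQuotientBy I T π :=
  hI.toIdeal.exists_isQuotientBy

theorem IsQuotientBy.mem_annStep_iff {I : Set B} {f : B → C} (h : S.IsQuotientBy I T f)
    (x : S.El) : x ∈ S.annStep I ↔ IsAnn (h.isHom.addHom x) := by
  set π := h.isHom.addHom with hπ
  have h1 : ∀ b : S.El, S.add (S.lam x b) (S.neg b) ∈ I ↔
      lamHom T (π x) (π b) = π b := by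
    intro b
    refine (h.mem_iff (lamHom S x b + -b)).trans ?_
    rw [map_add, map_neg, ← sub_eq_add_neg, sub_eq_zero, h.isHom.addHom_lamHom]
  have h2 : ∀ b : S.El, S.add (S.add x b) (S.neg (S.add b x)) ∈ I ↔
      π x + π b = π b + π x := by
    intro b
    refine (h.mem_iff (x + b + -(b + x))).trans ?_
    rw [map_add, map_neg, ← sub_eq_add_neg, sub_eq_zero, map_add, map_add]
  have h3 : ∀ b : S.El, S.mul (S.mul x b) (S.inv (S.mul b x)) ∈ I ↔
      π x * π b = π b * π x := by
    intro b
    refine (h.mem_iff (x * b * (b * x)⁻¹)).trans ?_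
    rw [h.isHom.addHom_mul, h.isHom.addHom_inv, ← one_eq_zero, mul_inv_eq_one,
      h.isHom.addHom_mul, h.isHom.addHom_mul]
  constructor
  · intro hx
    have h1' : ∀ b, lamHom T (π x) b = b := by
      intro b
      obtain ⟨b, rfl⟩ := h.surjective b
      exact (h1 b).1 (hx.1 b)
    have h2' : ∀ b, π x + b = b + π x := by
      intro b
      obtain ⟨b, rfl⟩ := h.surjective b
      exact (h2 b).1 (hx.2.1 b)
    refine ⟨h2', h1', fun b => ?_⟩
    have h3' : π x * b = b * π x := by
      obtain ⟨b, rfl⟩ := h.surjective b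
      exact (h3 b).1 (hx.2.2 b)
    rw [lamHom_apply, ← h3', ← add_lamHom, h1', h2', neg_add_cancel_left]
  · intro hx
    refine ⟨fun b => (h1 b).2 (hx.2.1 _), fun b => (h2 b).2 (hx.1 _), fun b => (h3 b).2 ?_⟩
    rw [IsAnn.mul_eq_add hx, IsAnn.mul_eq_add' hx, hx.1]

theorem isIdeal_annStep {I : Set B} (hI : S.IsIdeal I) : S.IsIdeal (S.annStep I) := by
  obtain ⟨Q, T, π, h⟩ := exists_isQuotientBy hI
  have : S.annStep I = π ⁻¹' (annihilator T : Set T.El) := Set.ext h.mem_annStep_iff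
  rw [this]
  exact h.isHom.isIdeal_preimage (isIdeal_of_le_annihilator le_rfl)

theorem subset_annStep {I : Set B} (hI : S.IsIdeal I) : I ⊆ S.annStep I := by
  intro x hx
  obtain ⟨Q, T, π, h⟩ := exists_isQuotientBy hI
  refine (h.mem_annStep_iff x).2 ?_
  rw [(h.mem_iff x).1 hx]
  exact zero_mem (annihilator T)

end Hom

section AnnSeries

variable {B : Type u} (S : SkewBrace B)

theorem annSeries_zero : S.annSeries (0 : Ordinal.{v}) = {S.zero} :=
  Ordinal.limitRecOn_zero ..

theorem annSeries_add_one (o : Ordinal.{v}) :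
    S.annSeries (o + 1) = S.annStep (S.annSeries o) := Ordinal.limitRecOn_add_one ..

theorem annSeries_limit {o : Ordinal.{v}} (h : Order.IsSuccLimit o) :
    S.annSeries o = ⋃ β, ⋃ _ : β < o, S.annSeries β := Ordinal.limitRecOn_limit _ _ _ _ h

theorem isIdeal_annSeries_and_mono (o : Ordinal.{v}) :
    S.IsIdeal (S.annSeries o) ∧ ∀ β < o, S.annSeries β ⊆ S.annSeries o := by
  induction o using WellFoundedLT.induction with
  | ind o ih =>
  rcases Ordinal.zero_or_succ_or_isSuccLimit o with rfl | ⟨a, rfl⟩ | ho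
  · refine ⟨?_, fun β hβ => absurd hβ (by simp)⟩
    rw [annSeries_zero]
    exact isIdeal_of_le_annihilator (A := ⊥) bot_le
  · have ha := ih a (by simp)
    rw [Order.succ_eq_add_one, annSeries_add_one]
    refine ⟨isIdeal_annStep ha.1, fun β hβ => ?_⟩
    rcases (Order.lt_add_one_iff.1 hβ).lt_or_eq with h | rfl
    · exact (ha.2 β h).trans (subset_annStep ha.1)
    · exact subset_annStep ha.1
  · have hmem : ∀ x, x ∈ S.annSeries o ↔ ∃ β < o, x ∈ S.annSeries β := by
      intro x
      rw [annSeries_limit S ho]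
      simp
    have hle : ∀ β γ, β ≤ γ → γ < o → S.annSeries β ⊆ S.annSeries γ := by
      intro β γ h hγ
      rcases h.lt_or_eq with h | rfl
      · exact (ih γ hγ).2 β h
      · exact subset_rfl
    refine ⟨⟨⟨(hmem _).2 ⟨0, ho.bot_lt, ?_⟩, ?_, ?_⟩, ?_, ?_, ?_⟩,
      fun β hβ x hx => (hmem x).2 ⟨β, hβ, hx⟩⟩
    · exact (ih 0 ho.bot_lt).1.1.1
    · intro a ha b hb
      obtain ⟨β, hβ, ha⟩ := (hmem a).1 ha
      obtain ⟨γ, hγ, hb⟩ := (hmem b).1 hb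
      have hm := max_lt hβ hγ
      exact (hmem _).2 ⟨max β γ, hm, (ih _ hm).1.1.2.1 _ (hle _ _ (le_max_left _ _) hm ha) _
        (hle _ _ (le_max_right _ _) hm hb)⟩
    · intro a ha
      obtain ⟨β, hβ, ha⟩ := (hmem a).1 ha
      exact (hmem _).2 ⟨β, hβ, (ih β hβ).1.1.2.2 _ ha⟩
    all_goals
      intro b a ha
      obtain ⟨β, hβ, ha⟩ := (hmem a).1 ha
      refine (hmem _).2 ⟨β, hβ, ?_⟩
    · exact (ih β hβ).1.2.1 _ _ ha
    · exact (ih β hβ).1.2.2.1 _ _ ha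
    · exact (ih β hβ).1.2.2.2 _ _ ha

theorem isIdeal_annSeries (o : Ordinal.{v}) : S.IsIdeal (S.annSeries o) :=
  (S.isIdeal_annSeries_and_mono o).1

theorem annSeries_mono : Monotone (S.annSeries : Ordinal.{v} → Set B) := by
  intro β γ h
  rcases h.lt_or_eq with h | rfl
  · exact (S.isIdeal_annSeries_and_mono γ).2 β h
  · exact subset_rfl

end AnnSeries

section Descent

variable {F : Type u} {S : SkewBrace F}

/-- A finiteness condition on an ideal `I`: it is finitely generated as an ideal, both groups of
the quotient by `I` are finitely generated, and the additive group of the quotient is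
finitely presented. -/
structure IsTame (I : S.Ideal) : Prop where
  ideal_fg : ∃ R : Set S.El, R.Finite ∧ S.idealGen R = (I : Set S.El)
  quot_fg : ∃ Z : Set S.El, Z.Finite ∧ (∀ g, ∃ u ∈ AddSubgroup.closure Z, -u + g ∈ I) ∧
    ∀ g, ∃ v ∈ Subgroup.closure Z, -v + g ∈ I
  quot_fp : ∀ Z : Set S.El, Z.Finite → (∀ g, ∃ u ∈ AddSubgroup.closure Z, -u + g ∈ I) →
    ∃ W : Set (AddSubgroup.closure Z), W.Finite ∧
      AddSubgroup.normalClosure W = I.toAddSubgroup.addSubgroupOf (AddSubgroup.closure Z)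

theorem IsTame.of_eq_univ {X : Set S.El} (hXf : X.Finite) (hX : S.subGen X = Set.univ)
    {I : S.Ideal} (hI : ∀ x, x ∈ I) : IsTame I where
  ideal_fg := by
    refine ⟨X, hXf, Set.Subset.antisymm (idealGen_subset I.isIdeal fun x _ => hI x) ?_⟩
    intro x _
    have hsub : S.IsSub (S.idealGen X) := by
      let J := (isIdeal_idealGen (S := S) X).toIdeal
      exact ⟨zero_mem J.toAddSubgroup, fun _ ha _ hb => J.toAddSubgroup.add_mem ha hb,
        fun _ ha => J.toAddSubgroup.neg_mem ha, fun _ ha _ hb => J.toSubgroup.mul_mem ha hb,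
        fun _ ha => J.toSubgroup.inv_mem ha⟩
    exact subGen_subset hsub (subset_idealGen X) (hX ▸ Set.mem_univ x)
  quot_fg := ⟨∅, Set.finite_empty, fun _ => ⟨0, zero_mem _, hI _⟩, fun _ => ⟨1, one_mem _, hI _⟩⟩
  quot_fp := by
    intro Z hZf _
    refine ⟨(↑) ⁻¹' Z, hZf.preimage Subtype.val_injective.injOn, ?_⟩
    have htop : AddSubgroup.normalClosure ((↑) ⁻¹' Z : Set (AddSubgroup.closure Z)) = ⊤ := by
      rw [eq_top_iff, ← AddSubgroup.closure_closure_coe_preimage]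
      exact AddSubgroup.closure_le_normalClosure
    rw [htop, eq_comm, AddSubgroup.addSubgroupOf_eq_top]
    exact fun x _ => hI x

theorem exists_mem_closure_of_ann {K K' : S.Ideal} (hK : ∀ x ∈ K, x ∈ S.annStep (K' : Set S.El))
    {R : Set S.El} (hR : S.idealGen R = (K : Set S.El)) {k : S.El} (hk : k ∈ K) :
    ∃ a ∈ AddSubgroup.closure R, -a + k ∈ K' := by
  obtain ⟨Q, T, π, h⟩ := exists_isQuotientBy K'.isIdeal
  set p := h.isHom.addHom with hp
  have hann : AddSubgroup.closure (p '' R) ≤ annihilator T := by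
    rw [AddSubgroup.closure_le]
    rintro _ ⟨r, hr, rfl⟩
    exact (h.mem_annStep_iff r).1 (hK r (hR.subset (subset_idealGen R hr)))
  have hsub : S.idealGen R ⊆ π ⁻¹' (AddSubgroup.closure (p '' R) : Set T.El) :=
    idealGen_subset (h.isHom.isIdeal_preimage (isIdeal_of_le_annihilator hann)) fun r hr =>
      AddSubgroup.subset_closure (G := T.El) (Set.mem_image_of_mem p hr)
  have hpk : p k ∈ AddSubgroup.closure (p '' R) := hsub (hR.superset hk)
  rw [← AddMonoidHom.map_closure] at hpk
  obtain ⟨a, ha, hak⟩ := hpk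
  exact ⟨a, ha, (h.neg_add_mem_iff a k).2 hak⟩

theorem IsTame.of_le_annStep {X : Set S.El} (hXf : X.Finite) (hX : S.subGen X = Set.univ)
    {K K' : S.Ideal} (hle : ∀ x ∈ K', x ∈ K) (hK : ∀ x ∈ K, x ∈ S.annStep (K' : Set S.El))
    (hT : IsTame K) : IsTame K' := by
  obtain ⟨R, hRf, hR⟩ := hT.ideal_fg
  obtain ⟨Z₀, hZ₀f, hZ₀, hZ₀'⟩ := hT.quot_fg
  have hRK : ∀ r ∈ R, r ∈ K := fun r hr => hR.subset (subset_idealGen R hr)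
  set Z : Set S.El := Z₀ ∪ R ∪ X with hZdef
  have hZf : Z.Finite := (hZ₀f.union hRf).union hXf
  have hZ₀Z : Z₀ ⊆ Z := fun x hx => Or.inl (Or.inl hx)
  have hRZ : R ⊆ Z := fun x hx => Or.inl (Or.inr hx)
  have hXZ : X ⊆ Z := fun x hx => Or.inr hx
  have hKR : ∀ k, ∃ a ∈ AddSubgroup.closure R, k ∈ K → -a + k ∈ K' := by
    intro k
    by_cases hk : k ∈ K
    · obtain ⟨a, ha, h⟩ := exists_mem_closure_of_ann hK hR hk
      exact ⟨a, ha, fun _ => h⟩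
    · exact ⟨0, zero_mem _, fun h => absurd h hk⟩
  have hZK : ∀ g, ∃ u ∈ AddSubgroup.closure Z, -u + g ∈ K := by
    intro g
    obtain ⟨u, hu, h⟩ := hZ₀ g
    exact ⟨u, AddSubgroup.closure_mono hZ₀Z hu, h⟩
  choose q hqR hqK using hKR
  have hZK' : ∀ g, ∃ u ∈ AddSubgroup.closure Z, -u + g ∈ K' := by
    intro g
    obtain ⟨u, hu, h⟩ := hZK g
    refine ⟨u + q (-u + g), add_mem hu (AddSubgroup.closure_mono hRZ (hqR _)), ?_⟩
    have := hqK _ h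
    rwa [← _root_.add_assoc, ← neg_add_rev] at this
  choose p hpZ hpK using hZK'
  obtain ⟨W, hWf, hW⟩ := hT.quot_fp Z hZf hZK
  have hWK : ∀ w ∈ W, (w : S.El) ∈ K := by
    intro w hw
    have : w ∈ K.toAddSubgroup.addSubgroupOf (AddSubgroup.closure Z) :=
      hW ▸ AddSubgroup.subset_normalClosure hw
    exact this
  obtain ⟨Q', T', π', h'⟩ := exists_isQuotientBy K'.isIdeal
  have hRann : ∀ r ∈ R, IsAnn (h'.isHom.addHom r) := fun r hr =>
    (h'.mem_annStep_iff r).1 (hK r (hRK r hr))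
  obtain ⟨D, hDf, hDK, hD₁, hD₂, hD₃, hD₄, hD₅, hD₆⟩ : ∃ D : Set S.El, D.Finite ∧
      (∀ d ∈ D, d ∈ K') ∧ (∀ r ∈ R, ∀ z ∈ Z, -(r + z) + (z + r) ∈ D) ∧
      (∀ r ∈ R, ∀ z ∈ Z, -(lamHom S r z) + z ∈ D) ∧
      (∀ r ∈ R, ∀ z ∈ Z, -(lamHom S z r) + r ∈ D) ∧
      (∀ z ∈ Z, ∀ z' ∈ Z, -p (lamHom S z z') + lamHom S z z' ∈ D) ∧
      (∀ z ∈ Z, ∀ z' ∈ Z, -p (lamHom S z⁻¹ z') + lamHom S z⁻¹ z' ∈ D) ∧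
      ∀ w ∈ W, -q (w : S.El) + (w : S.El) ∈ D := by
    refine ⟨Set.image2 (fun r z => -(r + z) + (z + r)) R Z ∪
      Set.image2 (fun r z => -(lamHom S r z) + z) R Z ∪
      Set.image2 (fun r z => -(lamHom S z r) + r) R Z ∪
      Set.image2 (fun z z' => -p (lamHom S z z') + lamHom S z z') Z Z ∪
      Set.image2 (fun z z' => -p (lamHom S z⁻¹ z') + lamHom S z⁻¹ z') Z Z ∪
      (fun w : AddSubgroup.closure Z => -q (w : S.El) + (w : S.El)) '' W,
      (((((hRf.image2 _ hZf).union (hRf.image2 _ hZf)).union (hRf.image2 _ hZf)).union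
        (hZf.image2 _ hZf)).union (hZf.image2 _ hZf)).union (hWf.image _), ?_,
      fun r hr z hz => ?_, fun r hr z hz => ?_, fun r hr z hz => ?_, fun z hz z' hz' => ?_,
      fun z hz z' hz' => ?_, fun w hw => ?_⟩
    · rintro _ (((((⟨r, hr, z, hz, rfl⟩ | ⟨r, hr, z, hz, rfl⟩) | ⟨r, hr, z, hz, rfl⟩) |
        ⟨z, hz, z', hz', rfl⟩) | ⟨z, hz, z', hz', rfl⟩) | ⟨w, hw, rfl⟩)
      · refine (h'.neg_add_mem_iff _ _).2 ?_
        rw [map_add, map_add, (hRann r hr).1]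
      · refine (h'.neg_add_mem_iff _ _).2 ?_
        rw [h'.isHom.addHom_lamHom, (hRann r hr).2.1]
      · refine (h'.neg_add_mem_iff _ _).2 ?_
        rw [h'.isHom.addHom_lamHom, (hRann r hr).2.2]
      · exact hpK _
      · exact hpK _
      · exact hqK _ (hWK w hw)
    · exact Or.inl (Or.inl (Or.inl (Or.inl (Or.inl ⟨r, hr, z, hz, rfl⟩))))
    · exact Or.inl (Or.inl (Or.inl (Or.inl (Or.inr ⟨r, hr, z, hz, rfl⟩))))
    · exact Or.inl (Or.inl (Or.inl (Or.inr ⟨r, hr, z, hz, rfl⟩)))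
    · exact Or.inl (Or.inl (Or.inr ⟨z, hz, z', hz', rfl⟩))
    · exact Or.inl (Or.inr ⟨z, hz, z', hz', rfl⟩)
    · exact Or.inr ⟨w, hw, rfl⟩
  have hLK : S.idealGen D ⊆ (K' : Set S.El) := idealGen_subset K'.isIdeal hDK
  obtain ⟨Q, T, π, h⟩ := exists_isQuotientBy (isIdeal_idealGen (S := S) D)
  set f := h.isHom.addHom with hf
  have hrel : ∀ x y : S.El, -x + y ∈ D → f x = f y := fun x y hxy =>
    (h.neg_add_mem_iff x y).1 (subset_idealGen D hxy)
  have hcomm : ∀ r ∈ f '' R, ∀ z ∈ f '' Z, r + z = z + r := by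
    rintro _ ⟨r, hr, rfl⟩ _ ⟨z, hz, rfl⟩
    rw [← map_add, ← map_add]
    exact hrel _ _ (hD₁ r hr z hz)
  have hcl : ∀ Y : Set S.El, ∀ x ∈ AddSubgroup.closure Y, f x ∈ AddSubgroup.closure (f '' Y) :=
    fun Y x hx => AddMonoidHom.map_closure f Y ▸ AddSubgroup.mem_map_of_mem f hx
  have hRL : ∀ k ∈ K, f k ∈ T.idealGen (f '' R) := fun k hk =>
    h.isHom.image_idealGen_subset R (hR.superset hk)
  have hinter : ∀ u ∈ AddSubgroup.closure (f '' Z), u ∈ T.idealGen (f '' R) →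
      u ∈ AddSubgroup.closure (f '' R) := by
    intro u hu huR
    rw [← AddMonoidHom.map_closure] at hu
    obtain ⟨x, hx, rfl⟩ := hu
    have hsub : T.idealGen (f '' R) ⊆ π '' (K : Set S.El) :=
      idealGen_subset (h.isHom.isIdeal_image h.2.1 K.isIdeal) (Set.image_mono hRK)
    obtain ⟨k, hk, hkx⟩ : ∃ k : S.El, k ∈ K ∧ f k = f x := hsub huR
    have hxK : x ∈ K := by
      have := add_mem (S := S.Ideal) hk (hle _ (hLK ((h.neg_add_mem_iff k x).2 hkx)))
      rwa [add_neg_cancel_left] at this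
    set A := AddSubgroup.closure (f '' R) with hA
    let A' := A.comap (f.comp (AddSubgroup.closure Z).subtype)
    have hA' : A'.Normal := by
      refine ⟨fun n hn g => ?_⟩
      change f (g + n + -g : S.El) ∈ A
      have hn' : f n ∈ A := hn
      rw [map_add, map_add, map_neg,
        ← AddSubgroup.add_comm_of_mem_closure hcomm hn' (hcl Z g g.2), add_neg_cancel_right]
      exact hn'
    have hWA : AddSubgroup.normalClosure W ≤ A' := by
      refine AddSubgroup.normalClosure_le_normal fun w hw => ?_
      change f w ∈ A
      rw [← hrel _ _ (hD₆ w hw)]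
      exact hcl R _ (hqR _)
    rw [hW] at hWA
    exact hWA (x := ⟨x, hx⟩) hxK
  have hmul : ∀ v ∈ Subgroup.closure Z, f v ∈ Subgroup.closure (f '' Z) := fun v hv =>
    MonoidHom.map_closure h.isHom.mulHom Z ▸ Subgroup.mem_map_of_mem h.isHom.mulHom hv
  have hstab : ∀ z ∈ f '' Z, ∀ z' ∈ f '' Z, lamHom T z z' ∈ AddSubgroup.closure (f '' Z) ∧
      lamHom T z⁻¹ z' ∈ AddSubgroup.closure (f '' Z) := by
    rintro _ ⟨z, hz, rfl⟩ _ ⟨z', hz', rfl⟩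
    rw [← h.isHom.addHom_inv, ← h.isHom.addHom_lamHom, ← h.isHom.addHom_lamHom,
      ← hf, ← hrel _ _ (hD₄ z hz z' hz'), ← hrel _ _ (hD₅ z hz z' hz')]
    exact ⟨hcl Z _ (hpZ _), hcl Z _ (hpZ _)⟩
  obtain ⟨hVtop, hAnn⟩ := isAnn_of_relations (S := T) (Z := f '' Z) (R := f '' R)
    (Set.image_mono hRZ)
    (h.isHom.subGen_image_eq_univ h.2.1 (Set.eq_univ_of_univ_subset (hX ▸
      subGen_subset (isSub_subGen _) (hXZ.trans (subset_subGen _)))))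
    hcomm
    (by
      rintro _ ⟨r, hr, rfl⟩ _ ⟨z, hz, rfl⟩
      rw [← h.isHom.addHom_lamHom]
      exact hrel _ _ (hD₂ r hr z hz))
    (by
      rintro _ ⟨r, hr, rfl⟩ _ ⟨z, hz, rfl⟩
      rw [← h.isHom.addHom_lamHom]
      exact hrel _ _ (hD₃ r hr z hz))
    hstab hinter
    (by
      intro g
      obtain ⟨g, rfl⟩ := h.surjective g
      obtain ⟨v, hv, hvg⟩ := hZ₀' g
      refine ⟨f v, hmul v (Subgroup.closure_mono hZ₀Z hv), ?_⟩
      rw [← map_neg, ← map_add]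
      exact hRL _ hvg)
  have hAle : AddSubgroup.closure (f '' R) ≤ annihilator T :=
    (AddSubgroup.closure_le _).2 hAnn
  refine ⟨?_, ⟨Z, hZf, fun g => ⟨p g, hpZ g, hpK g⟩, fun g => ?_⟩, fun Y hYf hY => ?_⟩
  · have hcen : AddSubgroup.closure (f '' R) ≤ AddSubgroup.center T.El := fun a ha =>
      AddSubgroup.mem_center_iff.2 fun b => ((hAle ha).1 b).symm
    obtain ⟨E, hEf, hE⟩ := AddSubgroup.exists_finite_closure_eq_of_le_center (hRf.image f) hcen
      (D := K'.toAddSubgroup.map f) (by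
        rintro _ ⟨k, hk, rfl⟩
        exact idealGen_subset (isIdeal_of_le_annihilator hAle)
          (AddSubgroup.subset_closure (G := T.El)) (hRL k (hle k hk)))
    have hEK : E ⊆ f '' (K' : Set S.El) := by
      intro e he
      have : e ∈ K'.toAddSubgroup.map f := hE ▸ AddSubgroup.subset_closure he
      exact this
    obtain ⟨E', hE'K, hE'f, rfl⟩ := hEf.exists_subset_image_eq hEK
    refine ⟨D ∪ E', hDf.union hE'f, Set.Subset.antisymm
      (idealGen_subset K'.isIdeal (Set.union_subset hDK hE'K)) fun (k : S.El) hk => ?_⟩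
    have hfk : f k ∈ AddSubgroup.closure (f '' E') := hE ▸ AddSubgroup.mem_map_of_mem f hk
    rw [← AddMonoidHom.map_closure] at hfk
    obtain ⟨e, he, hek⟩ := hfk
    let J := (isIdeal_idealGen (S := S) (D ∪ E')).toIdeal
    have he' : e ∈ J := (AddSubgroup.closure_le J.toAddSubgroup).2
      (Set.subset_union_right.trans (subset_idealGen (S := S) (D ∪ E'))) he
    have hek' : -e + k ∈ J := idealGen_subset J.isIdeal
      (Set.subset_union_left.trans (subset_idealGen (S := S) (D ∪ E')))
      ((h.neg_add_mem_iff e k).2 hek)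
    have := add_mem (S := S.Ideal) he' hek'
    rwa [add_neg_cancel_left] at this
  · have hg : f g ∈ Subgroup.closure (f '' Z) := hVtop ▸ Subgroup.mem_top _
    have hmap := MonoidHom.map_closure h.isHom.mulHom Z
    obtain ⟨v, hv, hvg⟩ : f g ∈ (Subgroup.closure Z).map h.isHom.mulHom := hmap ▸ hg
    exact ⟨v, hv, hLK ((h.neg_add_mem_iff v g).2 hvg)⟩
  · obtain ⟨W', hW'f, hW'⟩ := hT.quot_fp Y hYf fun g => by
      obtain ⟨u, hu, hug⟩ := hY g
      exact ⟨u, hu, hle _ hug⟩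
    refine AddSubgroup.exists_finite_normalClosure_eq_of_commutator
      (hYf.preimage Subtype.val_injective.injOn) AddSubgroup.closure_closure_coe_preimage
      (N := K.toAddSubgroup.addSubgroupOf _) (fun x hx => hle _ hx) (fun n hn g => ?_) hW'f hW'
    exact (hK n hn).2.1 (g : S.El)

end Descent

section Presentation

variable {F B : Type u} {T : SkewBrace F} {S : SkewBrace B}

/-- The preimage of a term of the upper annihilator series. -/
def IsHom.annPreimage {θ : F → B} (hθ : IsHom T S θ) (o : Ordinal.{v}) : T.Ideal :=
  (hθ.isIdeal_preimage (S.isIdeal_annSeries o)).toIdeal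

theorem IsHom.mem_annPreimage {θ : F → B} (hθ : IsHom T S θ) {o : Ordinal.{v}} {x : F} :
    x ∈ hθ.annPreimage o ↔ θ x ∈ S.annSeries o := Iff.rfl

theorem IsHom.mem_annStep_preimage {θ : F → B} (hθ : IsHom T S θ) {I : Set B} {x : F}
    (hx : θ x ∈ S.annStep I) : x ∈ T.annStep (θ ⁻¹' I) := by
  refine ⟨fun b => ?_, fun b => ?_, fun b => ?_⟩
  · rw [Set.mem_preimage, hθ.1, hθ.apply_neg, lam, hθ.1, hθ.2, hθ.apply_neg]
    exact hx.1 (θ b)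
  · rw [Set.mem_preimage, hθ.1, hθ.apply_neg, hθ.1, hθ.1]
    exact hx.2.1 (θ b)
  · rw [Set.mem_preimage, hθ.2, hθ.apply_inv, hθ.2, hθ.2]
    exact hx.2.2 (θ b)

theorem IsHom.isTame_annPreimage_zero {θ : F → B} (hθ : IsHom T S θ) {X : Set F}
    (hXf : X.Finite) (hX : T.subGen X = Set.univ) (o : Ordinal.{v})
    (ho : IsTame (hθ.annPreimage o)) : IsTame (hθ.annPreimage (0 : Ordinal.{v})) := by
  induction o using WellFoundedLT.induction with
  | ind o ih =>
  rcases Ordinal.zero_or_succ_or_isSuccLimit o with rfl | ⟨a, rfl⟩ | hlim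
  · exact ho
  · refine ih a (by simp) (ho.of_le_annStep hXf hX (fun x hx => ?_) fun x hx => ?_)
    · exact S.annSeries_mono (Order.le_succ a) hx
    · have hx' : θ x ∈ S.annSeries (Order.succ a) := hx
      rw [Order.succ_eq_add_one, annSeries_add_one] at hx'
      exact hθ.mem_annStep_preimage hx'
  · obtain ⟨R, hRf, hR⟩ := ho.ideal_fg
    have hmem : ∀ r, ∃ β, r ∈ R → β < o ∧ θ r ∈ S.annSeries β := by
      intro r
      by_cases hr : r ∈ R
      · have hr' : θ r ∈ S.annSeries o := hR.subset (subset_idealGen R hr)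
        rw [annSeries_limit S hlim] at hr'
        simp only [Set.mem_iUnion] at hr'
        obtain ⟨β, hβ, h⟩ := hr'
        exact ⟨β, fun _ => ⟨hβ, h⟩⟩
      · exact ⟨0, fun h => absurd h hr⟩
    choose β hβ using hmem
    have hlt : hRf.toFinset.sup β < o := (Finset.sup_lt_iff hlim.bot_lt).2 fun r hr =>
      (hβ r (hRf.mem_toFinset.1 hr)).1
    have heq : hθ.annPreimage o = hθ.annPreimage (hRf.toFinset.sup β) := by
      apply SetLike.coe_injective
      refine Set.Subset.antisymm ?_ fun x hx => S.annSeries_mono hlt.le hx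
      rw [← hR]
      exact idealGen_subset (hθ.annPreimage _).isIdeal fun r hr =>
        S.annSeries_mono (Finset.le_sup (hRf.mem_toFinset.2 hr)) (hβ r hr).2
    exact ih _ hlt (heq ▸ ho)

theorem IsHom.isTame_ker {θ : F → B} (hθ : IsHom T S θ) {X : Set F} (hXf : X.Finite)
    (hX : T.subGen X = Set.univ) (h : ∃ o : Ordinal.{v}, S.annSeries o = Set.univ) :
    IsTame (hθ.annPreimage (0 : Ordinal.{v})) := by
  obtain ⟨o, ho⟩ := h
  exact hθ.isTame_annPreimage_zero hXf hX o
    (IsTame.of_eq_univ hXf hX fun x => hθ.mem_annPreimage.2 (ho ▸ Set.mem_univ _))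

theorem IsHom.mem_annPreimage_zero {θ : F → B} (hθ : IsHom T S θ) {x : F} :
    x ∈ hθ.annPreimage (0 : Ordinal.{v}) ↔ θ x = S.zero := by
  rw [hθ.mem_annPreimage, annSeries_zero, Set.mem_singleton_iff]

theorem IsHom.addFG_and_mulFG {θ : F → B} (hθ : IsHom T S θ) (hs : Function.Surjective θ)
    (h : IsTame (hθ.annPreimage (0 : Ordinal.{v}))) : S.AddFG ∧ S.MulFG := by
  classical
  obtain ⟨Z, hZf, hZ, hZ'⟩ := h.quot_fg
  have hθeq : ∀ u g : T.El, -u + g ∈ hθ.annPreimage (0 : Ordinal.{v}) →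
      hθ.addHom u = hθ.addHom g := by
    intro u g hug
    have : hθ.addHom (-u + g) = 0 := hθ.mem_annPreimage_zero.1 hug
    rwa [map_add, map_neg, neg_add_eq_zero] at this
  refine ⟨⟨(hZf.image θ).toFinset, ?_⟩, ⟨(hZf.image θ).toFinset, ?_⟩⟩
  · rw [Set.Finite.coe_toFinset, addClosure_eq]
    refine Set.eq_univ_of_forall fun b => ?_
    obtain ⟨g, rfl⟩ := hs b
    obtain ⟨u, hu, hug⟩ := hZ g
    have := AddSubgroup.mem_map_of_mem hθ.addHom hu
    rw [AddMonoidHom.map_closure, hθeq u g hug] at this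
    exact this
  · rw [Set.Finite.coe_toFinset, mulClosure_eq]
    refine Set.eq_univ_of_forall fun b => ?_
    obtain ⟨g, rfl⟩ := hs b
    obtain ⟨u, hu, hug⟩ := hZ' g
    have := Subgroup.mem_map_of_mem hθ.mulHom hu
    rw [MonoidHom.map_closure, show hθ.mulHom u = hθ.mulHom g from hθeq u g hug] at this
    exact this

/-- A sub-skew brace, as a skew brace. -/
def IsSub.toSkewBrace {X : Set B} (h : S.IsSub X) : SkewBrace X where
  add a b := ⟨S.add a b, h.2.1 _ a.2 _ b.2⟩
  zero := ⟨S.zero, h.1⟩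
  neg a := ⟨S.neg a, h.2.2.1 _ a.2⟩
  mul a b := ⟨S.mul a b, h.2.2.2.1 _ a.2 _ b.2⟩
  inv a := ⟨S.inv a, h.2.2.2.2 _ a.2⟩
  add_assoc _ _ _ := Subtype.ext (S.add_assoc ..)
  zero_add _ := Subtype.ext (S.zero_add _)
  add_zero _ := Subtype.ext (S.add_zero _)
  neg_add _ := Subtype.ext (S.neg_add _)
  add_neg _ := Subtype.ext (S.add_neg _)
  mul_assoc _ _ _ := Subtype.ext (S.mul_assoc ..)
  zero_mul _ := Subtype.ext (S.zero_mul _)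
  mul_zero _ := Subtype.ext (S.mul_zero _)
  inv_mul _ := Subtype.ext (S.inv_mul _)
  mul_inv _ := Subtype.ext (S.mul_inv _)
  compat _ _ _ := Subtype.ext (S.compat ..)

theorem IsFreeOn.subGen_range_eq_univ {X : Type v} {ι : X → F} (h : IsFreeOn T ι) :
    T.subGen (Set.range ι) = Set.univ := by
  have hsub := isSub_subGen (S := T) (Set.range ι)
  obtain ⟨g, ⟨hg, hgι⟩, -⟩ := h _ hsub.toSkewBrace
    fun x => ⟨ι x, subset_subGen _ (Set.mem_range_self x)⟩
  have hid : (fun x => (g x : F)) = id :=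
    (h F T ι).unique
      ⟨⟨fun a b => congrArg Subtype.val (hg.1 a b), fun a b => congrArg Subtype.val (hg.2 a b)⟩,
        fun x => congrArg Subtype.val (hgι x)⟩
      ⟨⟨fun _ _ => rfl, fun _ _ => rfl⟩, fun _ => rfl⟩
  refine Set.eq_univ_of_forall fun x => ?_
  exact Set.mem_of_eq_of_mem (congrFun hid x).symm (g x).2

theorem FinitelyPresented.finitelyGenerated (h : S.FinitelyPresented) :
    S.FinitelyGenerated := by
  classical
  obtain ⟨F, T, m, ι, θ, hfree, hθ, hs, -⟩ := h
  have hf : (θ '' Set.range ι).Finite := (Set.finite_range ι).image θ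
  refine ⟨hf.toFinset, ?_⟩
  rw [hf.coe_toFinset]
  exact hθ.subGen_image_eq_univ hs hfree.subGen_range_eq_univ

theorem AddFG.finitelyGenerated (h : S.AddFG) : S.FinitelyGenerated := by
  obtain ⟨X, hX⟩ := h
  refine ⟨X, Set.eq_univ_of_univ_subset ?_⟩
  rw [← hX]
  exact fun x hx Y hY => hx Y ⟨⟨hY.1.1, hY.1.2.1, hY.1.2.2.1⟩, hY.2⟩

theorem MulFG.finitelyGenerated (h : S.MulFG) : S.FinitelyGenerated := by
  obtain ⟨X, hX⟩ := h
  refine ⟨X, Set.eq_univ_of_univ_subset ?_⟩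
  rw [← hX]
  exact fun x hx Y hY => hx Y ⟨⟨hY.1.1, hY.1.2.2.2⟩, hY.2⟩

end Presentation

section Free

/-- Terms in the language of skew braces. -/
inductive Term (X : Type v) : Type (max u v)
  | of (x : X) : Term X
  | zero : Term X
  | add (a b : Term X) : Term X
  | neg (a : Term X) : Term X
  | mul (a b : Term X) : Term X
  | inv (a : Term X) : Term X

variable {X : Type v}

/-- The value of a term in a skew brace. -/
def Term.eval {C : Type u} (S : SkewBrace C) (f : X → C) : Term.{u} X → C
  | .of x => f x
  | .zero => S.zero
  | .add a b => S.add (a.eval S f) (b.eval S f)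
  | .neg a => S.neg (a.eval S f)
  | .mul a b => S.mul (a.eval S f) (b.eval S f)
  | .inv a => S.inv (a.eval S f)

/-- Two terms are equivalent if they have the same value in all skew braces. -/
def termSetoid (X : Type v) : Setoid (Term.{u} X) where
  r a b := ∀ (C : Type u) (S : SkewBrace C) (f : X → C), a.eval S f = b.eval S f
  iseqv := ⟨fun _ _ _ _ => rfl, fun h C S f => (h C S f).symm,
    fun h h' C S f => (h C S f).trans (h' C S f)⟩

/-- The free skew brace. -/
def free (X : Type v) : SkewBrace (Quotient (termSetoid.{u} X)) where
  add := Quotient.map₂ Term.add fun _ _ h _ _ h' C S f => congrArg₂ S.add (h C S f) (h' C S f)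
  zero := Quotient.mk _ Term.zero
  neg := Quotient.map Term.neg fun _ _ h C S f => congrArg S.neg (h C S f)
  mul := Quotient.map₂ Term.mul fun _ _ h _ _ h' C S f => congrArg₂ S.mul (h C S f) (h' C S f)
  inv := Quotient.map Term.inv fun _ _ h C S f => congrArg S.inv (h C S f)
  add_assoc := by
    rintro ⟨a⟩ ⟨b⟩ ⟨c⟩
    exact Quotient.sound fun C S f => S.add_assoc ..
  zero_add := by
    rintro ⟨a⟩
    exact Quotient.sound fun C S f => S.zero_add _
  add_zero := by
    rintro ⟨a⟩
    exact Quotient.sound fun C S f => S.add_zero _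
  neg_add := by
    rintro ⟨a⟩
    exact Quotient.sound fun C S f => S.neg_add _
  add_neg := by
    rintro ⟨a⟩
    exact Quotient.sound fun C S f => S.add_neg _
  mul_assoc := by
    rintro ⟨a⟩ ⟨b⟩ ⟨c⟩
    exact Quotient.sound fun C S f => S.mul_assoc ..
  zero_mul := by
    rintro ⟨a⟩
    exact Quotient.sound fun C S f => S.zero_mul _
  mul_zero := by
    rintro ⟨a⟩
    exact Quotient.sound fun C S f => S.mul_zero _
  inv_mul := by
    rintro ⟨a⟩
    exact Quotient.sound fun C S f => S.inv_mul _
  mul_inv := by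
    rintro ⟨a⟩
    exact Quotient.sound fun C S f => S.mul_inv _
  compat := by
    rintro ⟨a⟩ ⟨b⟩ ⟨c⟩
    exact Quotient.sound fun C S f => S.compat ..

theorem exists_isFreeOn (X : Type) :
    ∃ (F : Type u) (T : SkewBrace F) (ι : X → F), IsFreeOn T ι := by
  refine ⟨_, free.{u} X, fun x => Quotient.mk _ (Term.of x), fun C S f => ?_⟩
  refine ⟨Quotient.lift (Term.eval S f) fun a b h => h C S f, ⟨⟨?_, ?_⟩, fun x => rfl⟩, ?_⟩
  · rintro ⟨a⟩ ⟨b⟩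
    rfl
  · rintro ⟨a⟩ ⟨b⟩
    rfl
  · rintro g ⟨hg, hgf⟩
    funext x
    obtain ⟨a, rfl⟩ := Quotient.exists_rep x
    change g (Quotient.mk _ a) = a.eval S f
    induction a with
    | of x => exact hgf x
    | zero => exact hg.apply_zero
    | add a b ha hb => exact (hg.1 (Quotient.mk _ a) (Quotient.mk _ b)).trans (by rw [ha, hb]; rfl)
    | neg a ha => exact (hg.apply_neg (Quotient.mk _ a)).trans (by rw [ha]; rfl)
    | mul a b ha hb => exact (hg.2 (Quotient.mk _ a) (Quotient.mk _ b)).trans (by rw [ha, hb]; rfl)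
    | inv a ha => exact (hg.apply_inv (Quotient.mk _ a)).trans (by rw [ha]; rfl)

theorem FinitelyGenerated.exists_surjective {B : Type u} {S : SkewBrace B}
    (h : S.FinitelyGenerated) :
    ∃ (F : Type u) (T : SkewBrace F) (m : ℕ) (ι : Fin m → F) (θ : F → B),
      IsFreeOn T ι ∧ IsHom T S θ ∧ Function.Surjective θ := by
  obtain ⟨X, hX⟩ := h
  obtain ⟨F, T, ι, hfree⟩ := exists_isFreeOn.{u} (Fin X.card)
  obtain ⟨θ, ⟨hθ, hθι⟩, -⟩ := hfree B S fun i => X.equivFin.symm i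
  refine ⟨F, T, _, ι, θ, hfree, hθ, Set.range_eq_univ.1 (Set.eq_univ_of_univ_subset ?_)⟩
  rw [← hX]
  refine subGen_subset hθ.isSub_range fun x hx => ⟨ι (X.equivFin ⟨x, hx⟩), ?_⟩
  rw [hθι, Equiv.symm_apply_apply]

end Free

end SkewBrace

/-- **Theorem.** Let `B` be an annihilator hypercentral skew brace. The following are
equivalent: (1) `B` is finitely generated as a skew brace; (2) `B` is finitely
presented as a skew brace; (3) the group `(B,+)` is finitely generated; (4) the
group `(B,∘)` is finitely generated. -/
theorem tfae_of_annihilator_hypercentral {B : Type u} (S : SkewBrace B)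
    (hhc : ∃ o : Ordinal.{u}, S.annSeries o = Set.univ) :
    List.TFAE [S.FinitelyGenerated, S.FinitelyPresented, S.AddFG, S.MulFG] := by
  have key : S.FinitelyGenerated → S.FinitelyPresented ∧ S.AddFG ∧ S.MulFG := by
    intro h
    obtain ⟨F, T, m, ι, θ, hfree, hθ, hs⟩ := h.exists_surjective
    have hT := hθ.isTame_ker (Set.finite_range ι) hfree.subGen_range_eq_univ hhc
    obtain ⟨R, hRf, hR⟩ : ∃ R : Set F, R.Finite ∧ T.idealGen R = {x | x ∈ hθ.annPreimage 0} :=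
      hT.ideal_fg
    refine ⟨⟨F, T, m, ι, θ, hfree, hθ, hs, hRf.toFinset, ?_⟩, hθ.addFG_and_mulFG hs hT⟩
    rw [hRf.coe_toFinset]
    exact (Set.ext fun x => hθ.mem_annPreimage_zero.symm).trans hR.symm
  tfae_have 1 → 2 := fun h => (key h).1
  tfae_have 2 → 1 := SkewBrace.FinitelyPresented.finitelyGenerated
  tfae_have 1 → 3 := fun h => (key h).2.1
  tfae_have 3 → 1 := SkewBrace.AddFG.finitelyGenerated
  tfae_have 1 → 4 := fun h => (key h).2.2
  tfae_have 4 → 1 := SkewBrace.MulFG.finitelyGenerated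
  tfae_finish
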